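/- arXiv:1004.5008 — 3 statements merged into one kernel-verified Lean document; each statement's English description precedes it below -/
import Mathlib

section
/- Let Ω ⊂ ℝⁿ be a bounded open set and let f : Ω × ℝ × ℝⁿ → ℝ be measurable and satisfy (H1) and (H2). If (u_j) is a sequence of Lipschitz functions on Ω with uniformly bounded Lipschitz constants and uniformly bounded sup-norms that converges uniformly on Ω to a Lipschitz function u (so that u_j → u weakly* in W^{1,∞}(Ω)), then liminf_{j→∞} F(u_j, Ω) ≥ F(u, Ω). (Sequential weak* lower semicontinuity of the supremal functional.) -/
open MeasureTheory Filter Set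

/-- The supremal functional `F(u,V) = ess sup_{x ∈ V} f(x, u(x), Du(x))`, valued in `EReal`. -/
noncomputable def suprF {n : ℕ} (f : EuclideanSpace ℝ (Fin n) → ℝ → EuclideanSpace ℝ (Fin n) → ℝ)
    (u : EuclideanSpace ℝ (Fin n) → ℝ) (V : Set (EuclideanSpace ℝ (Fin n))) : EReal :=
  essSup (fun x => ((f x (u x) (gradient u x) : ℝ) : EReal)) (volume.restrict V)

/-- Hypothesis (H1): lower semicontinuity in `(s,p)` for a.e. `x ∈ Ω`, and
quasiconvexity (level-convexity) of `p ↦ f x s p` for all `(x,s)`. -/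
def H1 {n : ℕ} (Ω : Set (EuclideanSpace ℝ (Fin n)))
    (f : EuclideanSpace ℝ (Fin n) → ℝ → EuclideanSpace ℝ (Fin n) → ℝ) : Prop :=
  (∀ᵐ x ∂(volume.restrict Ω),
      LowerSemicontinuous (fun sp : ℝ × EuclideanSpace ℝ (Fin n) => f x sp.1 sp.2)) ∧
  (∀ x ∈ Ω, ∀ s : ℝ, ∀ p q : EuclideanSpace ℝ (Fin n), ∀ t : ℝ, 0 ≤ t → t ≤ 1 →
      f x s (t • p + (1 - t) • q) ≤ max (f x s p) (f x s q))

/-- Hypothesis (H2): uniform coercivity. -/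
def H2 {n : ℕ} (Ω : Set (EuclideanSpace ℝ (Fin n)))
    (f : EuclideanSpace ℝ (Fin n) → ℝ → EuclideanSpace ℝ (Fin n) → ℝ) : Prop :=
  ∀ c : ℝ, ∃ R : ℝ, 0 ≤ R ∧ ∀ x ∈ Ω, ∀ s : ℝ, ∀ p : EuclideanSpace ℝ (Fin n),
    f x s p ≤ c → ‖p‖ ≤ R

/-- `u` is a bounded Lipschitz function on `V` (i.e. `u ∈ W^{1,∞}(V)`). -/
def BddLipschitzOn {n : ℕ} (u : EuclideanSpace ℝ (Fin n) → ℝ)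
    (V : Set (EuclideanSpace ℝ (Fin n))) : Prop :=
  (∃ K : NNReal, LipschitzOnWith K u V) ∧ ∃ M : ℝ, ∀ x ∈ V, |u x| ≤ M

/-- `u` is locally Lipschitz on `Ω`. -/
def LocLipschitzOn {n : ℕ} (u : EuclideanSpace ℝ (Fin n) → ℝ)
    (Ω : Set (EuclideanSpace ℝ (Fin n))) : Prop :=
  ∀ x ∈ Ω, ∃ s ∈ nhds x, ∃ K : NNReal, LipschitzOnWith K u s

/-- The Dirichlet class `W_g^{1,∞}(Ω)`: bounded Lipschitz functions `u` on `Ω` such that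
`u - g` extends continuously by zero to the boundary `∂Ω`. -/
def DirichletClass {n : ℕ} (Ω : Set (EuclideanSpace ℝ (Fin n)))
    (g u : EuclideanSpace ℝ (Fin n) → ℝ) : Prop :=
  BddLipschitzOn u Ω ∧
  ∀ x ∈ frontier Ω, Tendsto (fun y => u y - g y) (nhdsWithin x Ω) (nhds 0)

/-- `u ∈ A(g,Ω)`: `u` minimizes `F(·,Ω)` over `W_g^{1,∞}(Ω)`. -/
def Minimizes {n : ℕ} (f : EuclideanSpace ℝ (Fin n) → ℝ → EuclideanSpace ℝ (Fin n) → ℝ)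
    (Ω : Set (EuclideanSpace ℝ (Fin n))) (g u : EuclideanSpace ℝ (Fin n) → ℝ) : Prop :=
  DirichletClass Ω g u ∧ ∀ v, DirichletClass Ω g v → suprF f u Ω ≤ suprF f v Ω

/-- `u` is an absolute superminimizer of `F` on `Ω`. -/
def AbsSuper {n : ℕ} (f : EuclideanSpace ℝ (Fin n) → ℝ → EuclideanSpace ℝ (Fin n) → ℝ)
    (Ω : Set (EuclideanSpace ℝ (Fin n))) (u : EuclideanSpace ℝ (Fin n) → ℝ) : Prop :=
  ∀ V : Set (EuclideanSpace ℝ (Fin n)), IsOpen V → IsCompact (closure V) → closure V ⊆ Ω →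
    ∀ v : EuclideanSpace ℝ (Fin n) → ℝ,
      (∃ K : NNReal, LipschitzOnWith K v V) → ContinuousOn v (closure V) →
      (∀ x ∈ V, u x < v x) → (∀ x ∈ frontier V, v x = u x) →
      suprF f u V ≤ suprF f v V

/-- `u` is an absolute subminimizer of `F` on `Ω`. -/
def AbsSub {n : ℕ} (f : EuclideanSpace ℝ (Fin n) → ℝ → EuclideanSpace ℝ (Fin n) → ℝ)
    (Ω : Set (EuclideanSpace ℝ (Fin n))) (u : EuclideanSpace ℝ (Fin n) → ℝ) : Prop :=
  ∀ V : Set (EuclideanSpace ℝ (Fin n)), IsOpen V → IsCompact (closure V) → closure V ⊆ Ω →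
    ∀ v : EuclideanSpace ℝ (Fin n) → ℝ,
      (∃ K : NNReal, LipschitzOnWith K v V) → ContinuousOn v (closure V) →
      (∀ x ∈ V, v x < u x) → (∀ x ∈ frontier V, v x = u x) →
      suprF f u V ≤ suprF f v V

/-- `u` is an absolute minimizer of `F` on `Ω`: `F(v,V) ≥ F(u,V)` for every `V ⊂⊂ Ω` and every
`v ∈ W^{1,∞}(V) ∩ C(V̄)` with `v = u` on `∂V`. -/
def AbsMin {n : ℕ} (f : EuclideanSpace ℝ (Fin n) → ℝ → EuclideanSpace ℝ (Fin n) → ℝ)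
    (Ω : Set (EuclideanSpace ℝ (Fin n))) (u : EuclideanSpace ℝ (Fin n) → ℝ) : Prop :=
  ∀ V : Set (EuclideanSpace ℝ (Fin n)), IsOpen V → IsCompact (closure V) → closure V ⊆ Ω →
    ∀ v : EuclideanSpace ℝ (Fin n) → ℝ,
      (∃ K : NNReal, LipschitzOnWith K v V) → ContinuousOn v (closure V) →
      (∀ x ∈ frontier V, v x = u x) →
      suprF f u V ≤ suprF f v V

open scoped Topology NNReal Convolution

section LineDeriv

variable {E : Type*} [NormedAddCommGroup E] [InnerProductSpace ℝ E] [FiniteDimensional ℝ E]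
  [MeasurableSpace E] [BorelSpace E] {μ : Measure E} [μ.IsAddHaarMeasure]

/-- Weak convergence of the line derivatives of a pointwise convergent sequence of uniformly
Lipschitz functions, tested against a smooth compactly supported function. -/
theorem tendsto_integral_lineDeriv_mul {Ω : Set E} {v : ℕ → E → ℝ} {w ψ : E → ℝ} {K K' : ℝ≥0}
    (hv : ∀ j, LipschitzWith K (v j)) (hw : LipschitzWith K' w)
    (hvw : ∀ x ∈ Ω, Tendsto (fun j => v j x) atTop (𝓝 (w x)))
    (hψ : ContDiff ℝ 1 ψ) (hψc : HasCompactSupport ψ) (hψΩ : tsupport ψ ⊆ Ω) (q : E) :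
    Tendsto (fun j => ∫ x, lineDeriv ℝ (v j) x q * ψ x ∂μ) atTop
      (𝓝 (∫ x, lineDeriv ℝ w x q * ψ x ∂μ)) := by
  obtain ⟨D, hD⟩ := hψ.lipschitzWith_of_hasCompactSupport hψc one_ne_zero
  simp only [(hv _).integral_lineDeriv_mul_eq hD hψc, hw.integral_lineDeriv_mul_eq hD hψc]
  have hline : ∀ x, lineDeriv ℝ ψ x (-q) = fderiv ℝ ψ x (-q) := fun x =>
    (hψ.differentiable one_ne_zero x).lineDeriv_eq_fderiv
  simp only [hline]
  have hcont : Continuous fun x => fderiv ℝ ψ x (-q) :=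
    (hψ.continuous_fderiv one_ne_zero).clm_apply continuous_const
  have hsupp : HasCompactSupport fun x => fderiv ℝ ψ x (-q) := hψc.fderiv_apply ℝ (-q)
  have hzero : ∀ x, x ∉ Ω → fderiv ℝ ψ x (-q) = 0 := fun x hx => by
    have : x ∉ Function.support (fderiv ℝ ψ) := fun h => hx (hψΩ (support_fderiv_subset ℝ h))
    rw [Function.notMem_support.1 this]; rfl
  rcases Ω.eq_empty_or_nonempty with rfl | ⟨x₀, hx₀⟩
  · simp [fun x => hzero x (by simp)]
  obtain ⟨B, hB⟩ := (hvw x₀ hx₀).norm.bddAbove_range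
  refine tendsto_integral_of_dominated_convergence
    (fun x => ‖fderiv ℝ ψ x (-q)‖ * (B + K * dist x x₀)) ?_ ?_ ?_ ?_
  · exact fun j => (hcont.mul (hv j).continuous).aestronglyMeasurable
  · refine Continuous.integrable_of_hasCompactSupport (by fun_prop) hsupp.norm.mul_right
  · intro j
    refine Eventually.of_forall fun x => ?_
    rw [norm_mul]
    gcongr
    have h1 : ‖v j x₀‖ ≤ B := hB ⟨j, rfl⟩
    have h2 := (hv j).dist_le_mul x x₀
    rw [dist_eq_norm] at h2
    calc ‖v j x‖ = ‖v j x₀ + (v j x - v j x₀)‖ := by congr 1; ring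
      _ ≤ B + K * dist x x₀ := (norm_add_le _ _).trans (add_le_add h1 h2)
  · refine Eventually.of_forall fun x => ?_
    by_cases hx : x ∈ Ω
    · exact (hvw x hx).const_mul _
    · simp [hzero x hx]

/-- A common upper bound for the line derivatives of a pointwise convergent sequence of uniformly
Lipschitz functions is almost everywhere an upper bound for the line derivative of the limit. -/
theorem ae_lineDeriv_le_of_tendsto {Ω : Set E} (hΩ : IsOpen Ω) {v : ℕ → E → ℝ} {w g : E → ℝ}
    {K K' : ℝ≥0} (hv : ∀ j, LipschitzWith K (v j)) (hw : LipschitzWith K' w)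
    (hvw : ∀ x ∈ Ω, Tendsto (fun j => v j x) atTop (𝓝 (w x))) (hg : LocallyIntegrable g μ) (q : E)
    (hvg : ∀ j x, lineDeriv ℝ (v j) x q ≤ g x) :
    ∀ᵐ x ∂μ, x ∈ Ω → lineDeriv ℝ w x q ≤ g x := by
  let φ : ℕ → ContDiffBump (0 : E) := fun i =>
    ⟨1 / ((i : ℝ) + 1), 2 * (1 / ((i : ℝ) + 1)), by positivity,
      lt_two_mul_self (by positivity)⟩
  have hφ : Tendsto (fun i => (φ i).rOut) atTop (𝓝 0) := by
    simpa only [mul_zero] using (tendsto_one_div_add_atTop_nhds_zero_nat (𝕜 := ℝ)).const_mul 2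
  have hφ' : ∀ᶠ i in atTop, (φ i).rOut ≤ 2 * (φ i).rIn := Eventually.of_forall fun i => le_rfl
  filter_upwards [ContDiffBump.ae_convolution_tendsto_right_of_locallyIntegrable hφ hφ' hg,
    ContDiffBump.ae_convolution_tendsto_right_of_locallyIntegrable hφ hφ'
      (hw.locallyIntegrable_lineDeriv (μ := μ) q)] with x hxg hxw hx
  refine le_of_tendsto_of_tendsto hxw hxg ?_
  obtain ⟨ε, hε, hball⟩ := Metric.isOpen_iff.1 hΩ x hx
  filter_upwards [hφ.eventually_lt_const hε] with i hi
  rw [convolution_lsmul_swap, convolution_lsmul_swap]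
  set ψ : E → ℝ := fun t => (φ i).normed μ (x - t)
  have hψ : ContDiff ℝ 1 ψ := (φ i).contDiff_normed.comp (contDiff_const.sub contDiff_id)
  have hψnn : ∀ t, 0 ≤ ψ t := fun t => (φ i).nonneg_normed _
  have hsub : tsupport ψ ⊆ Metric.closedBall x (φ i).rOut := by
    refine closure_minimal (fun t ht => ?_) Metric.isClosed_closedBall
    have : x - t ∈ Function.support ((φ i).normed μ) := ht
    rw [(φ i).support_normed_eq, mem_ball_zero_iff] at this
    rw [Metric.mem_closedBall, dist_comm, dist_eq_norm]
    exact this.le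
  have hψc : HasCompactSupport ψ :=
    (isCompact_closedBall x _).of_isClosed_subset (isClosed_tsupport ψ) hsub
  have hψΩ : tsupport ψ ⊆ Ω :=
    (hsub.trans (Metric.closedBall_subset_ball hi)).trans hball
  have hint : ∀ h : E → ℝ, LocallyIntegrable h μ → Integrable (fun t => h t * ψ t) μ :=
    fun h hh => by
      simpa [mul_comm] using hh.integrable_smul_left_of_hasCompactSupport hψ.continuous hψc
  have key := le_of_tendsto' (tendsto_integral_lineDeriv_mul (μ := μ) hv hw hvw hψ hψc hψΩ q)
    fun j => integral_mono (hint _ ((hv j).locallyIntegrable_lineDeriv q)) (hint g hg)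
      fun t => mul_le_mul_of_nonneg_right (hvg j t) (hψnn t)
  simpa only [smul_eq_mul, mul_comm] using key

/-- The line derivative of the limit of a sequence of uniformly Lipschitz functions is bounded by
the supremum of the line derivatives along the sequence. -/
theorem ae_lineDeriv_le_iSup_of_tendsto {Ω : Set E} (hΩ : IsOpen Ω) {v : ℕ → E → ℝ} {w : E → ℝ}
    {K K' : ℝ≥0} (hv : ∀ j, LipschitzWith K (v j)) (hw : LipschitzWith K' w)
    (hvw : ∀ x ∈ Ω, Tendsto (fun j => v j x) atTop (𝓝 (w x))) (q : E) :
    ∀ᵐ x ∂μ, x ∈ Ω → lineDeriv ℝ w x q ≤ ⨆ j, lineDeriv ℝ (v j) x q := by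
  have hle : ∀ j x, ‖lineDeriv ℝ (v j) x q‖ ≤ K * ‖q‖ := fun j x =>
    norm_lineDeriv_le_of_lipschitz ℝ (hv j)
  have hbdd : ∀ x, BddAbove (range fun j => lineDeriv ℝ (v j) x q) := fun x =>
    ⟨K * ‖q‖, by rintro _ ⟨j, rfl⟩; exact (le_abs_self _).trans (hle j x)⟩
  refine ae_lineDeriv_le_of_tendsto hΩ hv hw hvw ?_ q fun j x => le_ciSup (hbdd x) j
  refine MemLp.locallyIntegrable (p := ⊤) ?_ le_top
  refine memLp_top_of_bound (C := K * ‖q‖) ?_ (Eventually.of_forall fun x => ?_)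
  · exact (Measurable.iSup fun j =>
      measurable_lineDeriv (hv j).continuous).aestronglyMeasurable
  · rw [Real.norm_eq_abs, abs_le]
    exact ⟨(abs_le.1 (hle 0 x)).1.trans (le_ciSup (hbdd x) 0),
      ciSup_le fun j => (abs_le.1 (hle j x)).2⟩

/-- At almost every point, in every direction, the derivative of the limit of a sequence of
uniformly Lipschitz functions is approached from below by derivatives along the sequence. -/
theorem ae_frequently_lt_inner_gradient {Ω : Set E} (hΩ : IsOpen Ω) {v : ℕ → E → ℝ}
    {w : E → ℝ} {K K' : ℝ≥0} (hv : ∀ j, LipschitzWith K (v j)) (hw : LipschitzWith K' w)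
    (hvw : ∀ x ∈ Ω, Tendsto (fun j => v j x) atTop (𝓝 (w x))) :
    ∀ᵐ x ∂μ, x ∈ Ω → ∀ (q : E) (a : ℝ), a < fderiv ℝ w x q →
      ∃ᶠ j in atTop, a < fderiv ℝ (v j) x q := by
  have hsup : ∀ᵐ x ∂μ, ∀ i m : ℕ, x ∈ Ω →
      lineDeriv ℝ w x (TopologicalSpace.denseSeq E i) ≤
        ⨆ j, lineDeriv ℝ (v (j + m)) x (TopologicalSpace.denseSeq E i) :=
    ae_all_iff.2 fun i => ae_all_iff.2 fun m =>
      ae_lineDeriv_le_iSup_of_tendsto hΩ (fun j => hv (j + m)) hw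
        (fun x hx => (hvw x hx).comp (tendsto_add_atTop_nat m)) _
  filter_upwards [hsup, ae_all_iff.2 fun j => (hv j).ae_differentiableAt (μ := μ),
    hw.ae_differentiableAt (μ := μ)] with x hx hdv hdw hxΩ q a ha
  obtain ⟨b, hab, hb⟩ := exists_between ha
  have hopen : IsOpen {q' : E | b < fderiv ℝ w x q' ∧ (K : ℝ) * ‖q' - q‖ < b - a} :=
    (isOpen_lt continuous_const (fderiv ℝ w x).continuous).inter
      (isOpen_lt (f := fun q' : E => (K : ℝ) * ‖q' - q‖) (by fun_prop) continuous_const)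
  obtain ⟨i, hi1, hi2⟩ := (TopologicalSpace.denseRange_denseSeq E).exists_mem_open hopen
    ⟨q, hb, by simpa using hab⟩
  set q' := TopologicalSpace.denseSeq E i
  refine frequently_atTop.2 fun m => ?_
  have h := hx i m hxΩ
  rw [hdw.lineDeriv_eq_fderiv] at h
  obtain ⟨j, hj⟩ := exists_lt_of_lt_ciSup (hi1.trans_le h)
  rw [(hdv _).lineDeriv_eq_fderiv] at hj
  refine ⟨j + m, Nat.le_add_left m j, ?_⟩
  have hclose : fderiv ℝ (v (j + m)) x (q' - q) ≤ K * ‖q' - q‖ :=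
    (le_abs_self _).trans ((fderiv ℝ (v (j + m)) x).le_of_opNorm_le
      (norm_fderiv_le_of_lipschitz ℝ (hv (j + m))) _)
  rw [map_sub] at hclose
  linarith

end LineDeriv

/-- A limit-type point `p` of a bounded sequence `P` (in the sense of support functions) stays in a
sublevel set of a jointly lower semicontinuous function with convex sublevel sets. -/
theorem LowerSemicontinuous.le_of_frequently_lt {E : Type*} [NormedAddCommGroup E]
    [NormedSpace ℝ E] [ProperSpace E] {h : ℝ × E → ℝ} (hh : LowerSemicontinuous h) {c s : ℝ}
    (hconv : Convex ℝ {p | h (s, p) ≤ c}) {S : ℕ → ℝ} {P : ℕ → E} {p : E} {R : ℝ}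
    (hS : Tendsto S atTop (𝓝 s)) (hP : ∀ j, ‖P j‖ ≤ R) (hle : ∀ j, h (S j, P j) ≤ c)
    (hp : ∀ (L : StrongDual ℝ E) (a : ℝ), a < L p → ∃ᶠ j in atTop, a < L (P j)) :
    h (s, p) ≤ c := by
  have hclosed : IsClosed {z | h z ≤ c} := hh.isClosed_preimage c
  by_contra hcon
  obtain ⟨L, a, hLa, hap⟩ := geometric_hahn_banach_closed_point hconv
    (hclosed.preimage (Continuous.prodMk_right s)) hcon
  obtain ⟨k, hk, hka⟩ := extraction_of_frequently_atTop (hp L a hap)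
  obtain ⟨p', -, k', hk', hlim⟩ := tendsto_subseq_of_bounded
    (Metric.isBounded_closedBall (x := (0 : E)) (r := R)) (x := P ∘ k)
    fun j => mem_closedBall_zero_iff.2 (hP _)
  have hp' : h (s, p') ≤ c :=
    hclosed.mem_of_tendsto
      (((hS.comp hk.tendsto_atTop).comp hk'.tendsto_atTop).prodMk_nhds hlim)
      (Eventually.of_forall fun j => hle _)
  exact (hLa p' hp').not_ge
    (ge_of_tendsto' ((L.continuous.tendsto p').comp hlim) fun j => (hka _).le)

/-- Sequential weak* lower semicontinuity of the supremal functional: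
if `u_j` are uniformly Lipschitz, uniformly bounded and converge uniformly on `Ω` to a
Lipschitz `u`, then `liminf_j F(u_j,Ω) ≥ F(u,Ω)`. -/
theorem stmt0 {n : ℕ} (Ω : Set (EuclideanSpace ℝ (Fin n)))
    (hΩo : IsOpen Ω) (hΩb : Bornology.IsBounded Ω)
    (f : EuclideanSpace ℝ (Fin n) → ℝ → EuclideanSpace ℝ (Fin n) → ℝ)
    (hfm : Measurable (fun q : EuclideanSpace ℝ (Fin n) × ℝ × EuclideanSpace ℝ (Fin n) =>
      f q.1 q.2.1 q.2.2))
    (h1 : H1 Ω f) (h2 : H2 Ω f)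
    (u : ℕ → EuclideanSpace ℝ (Fin n) → ℝ) (w : EuclideanSpace ℝ (Fin n) → ℝ)
    (K : NNReal) (M : ℝ)
    (hLip : ∀ j, LipschitzOnWith K (u j) Ω)
    (hBdd : ∀ j, ∀ x ∈ Ω, |u j x| ≤ M)
    (hw : ∃ K' : NNReal, LipschitzOnWith K' w Ω)
    (hconv : TendstoUniformlyOn u w atTop Ω) :
    suprF f w Ω ≤ atTop.liminf (fun j => suprF f (u j) Ω) := by
  obtain ⟨K', hw⟩ := hw
  choose v hv huv using fun j => (hLip j).extend_real
  obtain ⟨w', hw', hww'⟩ := hw.extend_real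
  have hnear : ∀ x ∈ Ω, ∀ {a b : EuclideanSpace ℝ (Fin n) → ℝ}, EqOn a b Ω →
      gradient a x = gradient b x := fun x hx a b hab =>
    (hab.eventuallyEq_of_mem (hΩo.mem_nhds hx)).gradient_eq
  have hvw : ∀ x ∈ Ω, Tendsto (fun j => v j x) atTop (𝓝 (w' x)) := fun x hx => by
    simpa only [← huv _ hx, ← hww' hx] using hconv.tendsto_at hx
  refine EReal.le_of_forall_lt_iff_le.1 fun c hc => ?_
  obtain ⟨k, hk, hkc⟩ := extraction_of_frequently_atTop (frequently_lt_of_liminf_lt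
    (by isBoundedDefault) hc)
  have hfc : ∀ᵐ x ∂volume.restrict Ω, ∀ j,
      f x (u (k j) x) (gradient (u (k j)) x) ≤ c := ae_all_iff.2 fun j => by
    filter_upwards [ae_lt_of_essSup_lt (hkc j)] with x hx
    exact_mod_cast hx.le
  refine essSup_le_of_ae_le _ ?_
  filter_upwards [h1.1, hfc, ae_restrict_mem hΩo.measurableSet,
    ae_restrict_of_ae (ae_frequently_lt_inner_gradient (μ := volume) hΩo (fun j => hv (k j)) hw'
      fun x hx => (hvw x hx).comp hk.tendsto_atTop)] with x hlsc hle hx hfreq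
  rw [hnear x hx hww', hww' hx, EReal.coe_le_coe_iff]
  refine hlsc.le_of_frequently_lt (S := fun j => v (k j) x)
    (P := fun j => gradient (v (k j)) x) (R := K) ?_ ((hvw x hx).comp hk.tendsto_atTop)
    (fun j => ?_) (fun j => ?_) fun L a ha => ?_
  · intro p hp q hq t r ht hr htr
    obtain rfl : r = 1 - t := by linarith
    exact (h1.2 x hx _ p q t ht (by linarith)).trans (max_le hp hq)
  · rw [gradient, LinearIsometryEquiv.norm_map]
    exact norm_fderiv_le_of_lipschitz ℝ (hv (k j))
  · have := hle j
    rwa [hnear x hx (huv (k j)), huv (k j) hx] at this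
  · obtain ⟨q, rfl⟩ := (InnerProductSpace.toDual ℝ _).surjective L
    have hinner : ∀ g : EuclideanSpace ℝ (Fin n) → ℝ,
        InnerProductSpace.toDual ℝ _ q (gradient g x) = fderiv ℝ g x q := fun g => by
      rw [InnerProductSpace.toDual_apply_apply, real_inner_comm, inner_gradient_left]
    simp only [hinner]
    exact hfreq hx q a (ha.trans_eq (hinner w'))
end

section
/- Let Ω ⊂ ℝⁿ be a bounded open set, let f : Ω × ℝ × ℝⁿ → ℝ be measurable, and let u be a locally Lipschitz function on Ω. Then u is simultaneously an absolute superminimizer and an absolute subminimizer of F if and only if for every open V compactly contained in Ω and every v ∈ W^{1,∞}(V) ∩ C(V̄) with v = u on ∂V one has F(v,V) ≥ F(u,V). -/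
open MeasureTheory Filter Set

section

variable {E : Type*} [NormedAddCommGroup E] [NormedSpace ℝ E] [FiniteDimensional ℝ E]
  [MeasurableSpace E] [BorelSpace E] (μ : Measure E) [μ.IsAddHaarMeasure]

/-- The derivative of a function vanishes almost everywhere on any measurable set on which the
function vanishes and is differentiable. -/
lemma ae_hasFDerivAt_eq_zero_of_eqOn_zero {w : E → ℝ} {w' : E → E →L[ℝ] ℝ} {s : Set E}
    (hs : MeasurableSet s) (hw : ∀ x ∈ s, w x = 0) (hw' : ∀ x ∈ s, HasFDerivAt w (w' x) x) :
    ∀ᵐ x ∂μ.restrict s, w' x = 0 := by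
  rcases subsingleton_or_nontrivial E with hE | hE
  · exact Eventually.of_forall fun x => Subsingleton.elim _ _
  obtain ⟨e, he⟩ := exists_ne (0 : E)
  have happ : ApproximatesLinearOn (fun x => w x • e) (0 : E →L[ℝ] E) s 0 :=
    fun x hx y hy => by simp [hw x hx, hw y hy]
  filter_upwards [happ.norm_fderiv_sub_le μ hs (fun x => (w' x).smulRight e)
    fun x hx => ((hw' x hx).smul_const e).hasFDerivWithinAt] with x hx
  simpa [he] using hx

/-- **Rademacher's theorem** for locally Lipschitz real functions. -/
lemma ae_differentiableAt_of_locally_lipschitz {u : E → ℝ} {s : Set E}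
    (hu : ∀ x ∈ s, ∃ t ∈ nhds x, ∃ K : NNReal, LipschitzOnWith K u t) :
    ∀ᵐ x ∂μ, x ∈ s → DifferentiableAt ℝ u x := by
  rw [ae_iff]
  refine measure_null_of_locally_null _ fun x hx => ?_
  simp only [mem_ofPred_eq, Classical.not_imp] at hx
  obtain ⟨t, ht, K, hK⟩ := hu x hx.1
  have hti : interior t ∈ nhds x := interior_mem_nhds.2 ht
  refine ⟨_ ∩ interior t, inter_mem_nhdsWithin _ hti, ?_⟩
  refine measure_mono_null ?_
    (ae_iff.1 ((hK.mono interior_subset).ae_differentiableWithinAt_of_mem (μ := μ)))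
  rintro y ⟨hy, hyt⟩
  simp only [mem_ofPred_eq, Classical.not_imp] at hy ⊢
  exact ⟨hyt, fun h => hy.2 (h.differentiableAt (isOpen_interior.mem_nhds hyt))⟩

end

lemma LocLipschitzOn.continuousAt {n : ℕ} {u : EuclideanSpace ℝ (Fin n) → ℝ}
    {Ω : Set (EuclideanSpace ℝ (Fin n))} (hu : LocLipschitzOn u Ω)
    {x : EuclideanSpace ℝ (Fin n)} (hx : x ∈ Ω) : ContinuousAt u x := by
  obtain ⟨s, hs, K, hK⟩ := hu x hx
  exact hK.continuousOn.continuousAt hs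

/-- Two locally Lipschitz functions have the same gradient almost everywhere on the set where they
coincide. -/
lemma LocLipschitzOn.ae_gradient_eq {n : ℕ} {u v : EuclideanSpace ℝ (Fin n) → ℝ}
    {V : Set (EuclideanSpace ℝ (Fin n))} (hV : IsOpen V)
    (hu : LocLipschitzOn u V) (hv : LocLipschitzOn v V) :
    ∀ᵐ x, x ∈ V → u x = v x → gradient u x = gradient v x := by
  have hcu : ContinuousOn u V := fun x hx => (hu.continuousAt hx).continuousWithinAt
  have hcv : ContinuousOn v V := fun x hx => (hv.continuousAt hx).continuousWithinAt
  have hmeas : MeasurableSet (V ∩ {x | u x - v x = 0}) := by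
    have : V ∩ {x | u x - v x = 0} = V \ (V ∩ (fun x => u x - v x) ⁻¹' {0}ᶜ) := by
      ext x; simp
    rw [this]
    exact hV.measurableSet.diff
      ((hcu.sub hcv).isOpen_inter_preimage hV isOpen_compl_singleton).measurableSet
  have hs := (hmeas.inter (measurableSet_of_differentiableAt ℝ u)).inter
    (measurableSet_of_differentiableAt ℝ v)
  have hae := ae_hasFDerivAt_eq_zero_of_eqOn_zero volume
    (w := fun x => u x - v x) (w' := fun x => fderiv ℝ u x - fderiv ℝ v x) hs
    (fun x hx => hx.1.1.2) fun x hx => hx.1.2.hasFDerivAt.sub hx.2.hasFDerivAt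
  filter_upwards [(ae_restrict_iff' hs).1 hae,
    ae_differentiableAt_of_locally_lipschitz volume hu,
    ae_differentiableAt_of_locally_lipschitz volume hv] with x hx hux hvx hxV huv
  rw [gradient, gradient, sub_eq_zero.1 (hx ⟨⟨⟨hxV, sub_eq_zero.2 huv⟩, hux hxV⟩, hvx hxV⟩)]

lemma isOpen_inter_lt {X : Type*} [TopologicalSpace X] {V : Set X} (hV : IsOpen V)
    {a b : X → ℝ} (ha : ContinuousOn a V) (hb : ContinuousOn b V) :
    IsOpen (V ∩ {x | a x < b x}) := by
  simpa [preimage, sub_pos] using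
    (hb.sub ha).isOpen_inter_preimage hV (isOpen_Ioi (a := (0 : ℝ)))

/-- If two functions are continuous on the closure of an open set and agree on its boundary, they
agree on the boundary of the subset where one is strictly smaller. -/
lemma eq_of_mem_frontier_inter_lt {X : Type*} [TopologicalSpace X] {V : Set X} (hV : IsOpen V)
    {a b : X → ℝ} (ha : ContinuousOn a (closure V)) (hb : ContinuousOn b (closure V))
    (hab : ∀ x ∈ frontier V, a x = b x) {x : X} (hx : x ∈ frontier (V ∩ {x | a x < b x})) :
    a x = b x := by
  have hxV : x ∈ closure V := closure_mono inter_subset_left hx.1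
  by_cases hxm : x ∈ V
  · have hle : a x ≤ b x := by
      have hsub : V ∩ {x | a x < b x} ⊆ closure V := inter_subset_left.trans subset_closure
      exact ContinuousWithinAt.closure_le hx.1 ((ha x hxV).mono hsub) ((hb x hxV).mono hsub)
        fun y hy => hy.2.le
    have hopen := isOpen_inter_lt hV (ha.mono subset_closure) (hb.mono subset_closure)
    exact hle.antisymm (not_lt.1 fun h => hx.2 (hopen.interior_eq.symm ▸ ⟨hxm, h⟩))
  · exact hab x ⟨hxV, fun h => hxm (interior_subset h)⟩

lemma ae_le_of_suprF_le {n : ℕ}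
    {f : EuclideanSpace ℝ (Fin n) → ℝ → EuclideanSpace ℝ (Fin n) → ℝ}
    {u v : EuclideanSpace ℝ (Fin n) → ℝ} {W V : Set (EuclideanSpace ℝ (Fin n))}
    (hW : IsOpen W) (hWV : W ⊆ V) (h : suprF f u W ≤ suprF f v W) :
    ∀ᵐ x, x ∈ W → ((f x (u x) (gradient u x) : ℝ) : EReal) ≤ suprF f v V := by
  have hmono : suprF f v W ≤ suprF f v V :=
    essSup_mono_measure' (Measure.restrict_mono_set volume hWV)
  rw [← ae_restrict_iff' hW.measurableSet]
  filter_upwards [ae_le_essSup (f := fun x => ((f x (u x) (gradient u x) : ℝ) : EReal))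
    (μ := volume.restrict W)] with x hx
  exact hx.trans (h.trans hmono)

/-- a locally Lipschitz `u` is simultaneously an absolute superminimizer and an
absolute subminimizer of `F` iff it is an absolute minimizer. -/
theorem stmt3 {n : ℕ} (Ω : Set (EuclideanSpace ℝ (Fin n)))
    (hΩo : IsOpen Ω) (hΩb : Bornology.IsBounded Ω)
    (f : EuclideanSpace ℝ (Fin n) → ℝ → EuclideanSpace ℝ (Fin n) → ℝ)
    (hfm : Measurable (fun q : EuclideanSpace ℝ (Fin n) × ℝ × EuclideanSpace ℝ (Fin n) =>
      f q.1 q.2.1 q.2.2))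
    (u : EuclideanSpace ℝ (Fin n) → ℝ) (hu : LocLipschitzOn u Ω) :
    (AbsSuper f Ω u ∧ AbsSub f Ω u) ↔ AbsMin f Ω u := by
  refine ⟨fun ⟨hsup, hsub⟩ V hVo hVc hVΩ v hvL hvc hvu => ?_, fun h =>
    ⟨fun V hVo hVc hVΩ v hvL hvc _ hvu => h V hVo hVc hVΩ v hvL hvc hvu,
      fun V hVo hVc hVΩ v hvL hvc _ hvu => h V hVo hVc hVΩ v hvL hvc hvu⟩⟩
  have huc : ContinuousOn u (closure V) :=
    fun x hx => (hu.continuousAt (hVΩ hx)).continuousWithinAt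
  have huV : LocLipschitzOn u V := fun x hx => hu x (hVΩ (subset_closure hx))
  obtain ⟨K, hK⟩ := hvL
  have hvV : LocLipschitzOn v V := fun x hx => ⟨V, hVo.mem_nhds hx, K, hK⟩
  have hclosure (W : Set (EuclideanSpace ℝ (Fin n))) (hW : W ⊆ V) : closure W ⊆ closure V :=
    closure_mono hW
  have hcompact (W : Set (EuclideanSpace ℝ (Fin n))) (hW : W ⊆ V) : IsCompact (closure W) :=
    hVc.of_isClosed_subset isClosed_closure (hclosure W hW)
  have hAo := isOpen_inter_lt hVo (huc.mono subset_closure) (hvc.mono subset_closure)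
  have hBo := isOpen_inter_lt hVo (hvc.mono subset_closure) (huc.mono subset_closure)
  have hA := hsup _ hAo (hcompact _ inter_subset_left)
    ((hclosure _ inter_subset_left).trans hVΩ) v ⟨K, hK.mono inter_subset_left⟩
    (hvc.mono (hclosure _ inter_subset_left)) (fun x hx => hx.2) fun x hx =>
      (eq_of_mem_frontier_inter_lt hVo huc hvc (fun y hy => (hvu y hy).symm) hx).symm
  have hB := hsub _ hBo (hcompact _ inter_subset_left)
    ((hclosure _ inter_subset_left).trans hVΩ) v ⟨K, hK.mono inter_subset_left⟩
    (hvc.mono (hclosure _ inter_subset_left)) (fun x hx => hx.2) fun x hx =>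
      eq_of_mem_frontier_inter_lt hVo hvc huc hvu hx
  refine essSup_le_of_ae_le _ ((ae_restrict_iff' hVo.measurableSet).2 ?_)
  filter_upwards [ae_le_of_suprF_le hAo inter_subset_left hA,
    ae_le_of_suprF_le hBo inter_subset_left hB, huV.ae_gradient_eq hVo hvV,
    (ae_restrict_iff' hVo.measurableSet).1
      (ae_le_essSup (f := fun x => ((f x (v x) (gradient v x) : ℝ) : EReal))
        (μ := volume.restrict V))] with x hxA hxB hxE hxv hxV
  rcases lt_trichotomy (u x) (v x) with h | h | h
  · exact hxA ⟨hxV, h⟩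
  · rw [hxE hxV h, h]
    exact hxv hxV
  · exact hxB ⟨hxV, h⟩
end

section
/- Let Ω ⊂ ℝⁿ be a bounded open set, let f : Ω × ℝ × ℝⁿ → ℝ be measurable, and let g be a bounded Lipschitz function on Ω. If u₁, u₂ ∈ W_g^{1,∞}(Ω) are both minimizers of F(·,Ω) over W_g^{1,∞}(Ω), then u = max(u₁, u₂) (and likewise min(u₁, u₂)) is also a minimizer of F(·,Ω) over W_g^{1,∞}(Ω). -/
open MeasureTheory Filter Set

/-- If `w` touches `u` at `x` from above or below and both are differentiable there, then the
gradients at `x` agree. -/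
lemma gradient_eq_of_touching {E : Type*} [NormedAddCommGroup E] [InnerProductSpace ℝ E]
    [CompleteSpace E] {u w : E → ℝ} {x : E} (hu : DifferentiableAt ℝ u x)
    (hw : DifferentiableAt ℝ w x) (hx : w x = u x)
    (h : (∀ y, u y ≤ w y) ∨ (∀ y, w y ≤ u y)) : gradient w x = gradient u x := by
  have hext : IsLocalExtr (fun y => w y - u y) x := by
    refine h.imp (fun h => ?_) (fun h => ?_) <;>
    · refine Eventually.of_forall fun y => ?_
      have := h y
      simp only [hx, sub_self]
      linarith
  have h0 := hext.fderiv_eq_zero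
  rw [fderiv_fun_sub hw hu, sub_eq_zero] at h0
  simp only [gradient, h0]

lemma BddLipschitzOn.ae_differentiableAt {n : ℕ} {Ω : Set (EuclideanSpace ℝ (Fin n))}
    (hΩ : IsOpen Ω) {u : EuclideanSpace ℝ (Fin n) → ℝ} (hu : BddLipschitzOn u Ω) :
    ∀ᵐ x ∂(volume.restrict Ω), DifferentiableAt ℝ u x := by
  obtain ⟨⟨K, hK⟩, -⟩ := hu
  filter_upwards [hK.ae_differentiableWithinAt (μ := volume) hΩ.measurableSet,
    ae_restrict_mem hΩ.measurableSet] with x hx hxΩ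
  exact hx.differentiableAt (hΩ.mem_nhds hxΩ)

/-- A competitor that agrees pointwise with one of two minimizers, and lies on one side of each,
is itself a minimizer. -/
lemma Minimizes.of_touching {n : ℕ} {Ω : Set (EuclideanSpace ℝ (Fin n))} (hΩ : IsOpen Ω)
    {f : EuclideanSpace ℝ (Fin n) → ℝ → EuclideanSpace ℝ (Fin n) → ℝ}
    {g u₁ u₂ w : EuclideanSpace ℝ (Fin n) → ℝ}
    (h₁ : Minimizes f Ω g u₁) (h₂ : Minimizes f Ω g u₂) (hw : DirichletClass Ω g w)
    (h : ∀ x, w x = u₁ x ∨ w x = u₂ x)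
    (hw₁ : (∀ x, u₁ x ≤ w x) ∨ (∀ x, w x ≤ u₁ x))
    (hw₂ : (∀ x, u₂ x ≤ w x) ∨ (∀ x, w x ≤ u₂ x)) : Minimizes f Ω g w := by
  refine ⟨hw, fun v hv => essSup_le_of_ae_le _ ?_⟩
  filter_upwards [hw.1.ae_differentiableAt hΩ, h₁.1.1.ae_differentiableAt hΩ,
    h₂.1.1.ae_differentiableAt hΩ,
    ae_le_essSup (f := fun x => ((f x (u₁ x) (gradient u₁ x) : ℝ) : EReal))
      (μ := volume.restrict Ω),
    ae_le_essSup (f := fun x => ((f x (u₂ x) (gradient u₂ x) : ℝ) : EReal))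
      (μ := volume.restrict Ω)] with x dw d₁ d₂ e₁ e₂
  rcases h x with hx | hx
  · rw [gradient_eq_of_touching d₁ dw hx hw₁, hx]
    exact e₁.trans (h₁.2 v hv)
  · rw [gradient_eq_of_touching d₂ dw hx hw₂, hx]
    exact e₂.trans (h₂.2 v hv)

lemma DirichletClass.max {n : ℕ} {Ω : Set (EuclideanSpace ℝ (Fin n))}
    {g u v : EuclideanSpace ℝ (Fin n) → ℝ}
    (hu : DirichletClass Ω g u) (hv : DirichletClass Ω g v) :
    DirichletClass Ω g (fun x => max (u x) (v x)) := by
  obtain ⟨⟨⟨K, hK⟩, M, hM⟩, hgu⟩ := hu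
  obtain ⟨⟨⟨L, hL⟩, N, hN⟩, hgv⟩ := hv
  refine ⟨⟨⟨Max.max K L, ?_⟩, Max.max M N, fun x hx => ?_⟩, fun x hx => ?_⟩
  · rw [lipschitzOnWith_iff_restrict] at *
    exact hK.max hL
  · exact abs_max_le_max_abs_abs.trans (max_le_max (hM x hx) (hN x hx))
  · simpa only [max_sub_sub_right, max_self] using (hgu x hx).max (hgv x hx)

lemma DirichletClass.min {n : ℕ} {Ω : Set (EuclideanSpace ℝ (Fin n))}
    {g u v : EuclideanSpace ℝ (Fin n) → ℝ}
    (hu : DirichletClass Ω g u) (hv : DirichletClass Ω g v) :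
    DirichletClass Ω g (fun x => min (u x) (v x)) := by
  obtain ⟨⟨⟨K, hK⟩, M, hM⟩, hgu⟩ := hu
  obtain ⟨⟨⟨L, hL⟩, N, hN⟩, hgv⟩ := hv
  refine ⟨⟨⟨Max.max K L, ?_⟩, Max.max M N, fun x hx => ?_⟩, fun x hx => ?_⟩
  · rw [lipschitzOnWith_iff_restrict] at *
    exact hK.min hL
  · exact abs_min_le_max_abs_abs.trans (max_le_max (hM x hx) (hN x hx))
  · simpa only [min_sub_sub_right, min_self] using (hgu x hx).min (hgv x hx)

/-- the pointwise max (and min) of two minimizers of `F(·,Ω)` over `W_g^{1,∞}(Ω)`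
is again a minimizer. -/
theorem stmt4 {n : ℕ} (Ω : Set (EuclideanSpace ℝ (Fin n)))
    (hΩo : IsOpen Ω) (hΩb : Bornology.IsBounded Ω)
    (f : EuclideanSpace ℝ (Fin n) → ℝ → EuclideanSpace ℝ (Fin n) → ℝ)
    (hfm : Measurable (fun q : EuclideanSpace ℝ (Fin n) × ℝ × EuclideanSpace ℝ (Fin n) =>
      f q.1 q.2.1 q.2.2))
    (g : EuclideanSpace ℝ (Fin n) → ℝ) (hg : BddLipschitzOn g Ω)
    (u₁ u₂ : EuclideanSpace ℝ (Fin n) → ℝ)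
    (h₁ : Minimizes f Ω g u₁) (h₂ : Minimizes f Ω g u₂) :
    Minimizes f Ω g (fun x => max (u₁ x) (u₂ x)) ∧
    Minimizes f Ω g (fun x => min (u₁ x) (u₂ x)) := by
  exact ⟨h₁.of_touching hΩo h₂ (h₁.1.max h₂.1) (fun _ => max_choice _ _)
      (.inl fun _ => le_max_left _ _) (.inl fun _ => le_max_right _ _),
    h₁.of_touching hΩo h₂ (h₁.1.min h₂.1) (fun _ => min_choice _ _)
      (.inr fun _ => min_le_left _ _) (.inr fun _ => min_le_right _ _)⟩
end
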